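/- Let Γ be a Coxeter graph with vertex set S and let X ⊆ S. For all β, γ ∈ Φ[Γ_X], the Coxeter matrix entry \hat m^X_{β,γ} of \widehat{Γ_X} (built from Γ_X) equals the Coxeter matrix entry \hat m_{β,γ} of \hat Γ (built from Γ); equivalently, the identity map on Φ[Γ_X] induces an isomorphism of Coxeter graphs between \widehat{Γ_X} and the full subgraph \hat Γ_{Φ[Γ_X]} of \hat Γ spanned by Φ[Γ_X]. -/

import Mathlib

/-- The coefficient `⟨α_s, α_t⟩` of the canonical bilinear form: `-2 cos (π / m_{s,t})` if
`m_{s,t} ≠ ∞` and `-2` if `m_{s,t} = ∞` (recall `M s t = 0` encodes `∞`). -/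
noncomputable def bilinCoeff {S : Type*} (M : CoxeterMatrix S) (s t : S) : ℝ :=
  if M s t = 0 then -2 else -2 * Real.cos (Real.pi / (M s t))

/-- The canonical symmetric bilinear form on `V = ⊕_{s ∈ S} ℝ α_s`, identified with `S → ℝ`. -/
noncomputable def canonicalForm {S : Type*} [Fintype S] (M : CoxeterMatrix S) (v w : S → ℝ) : ℝ :=
  ∑ s, ∑ t, v s * w t * bilinCoeff M s t

/-- The simple root `α_s`, as an element of `S → ℝ`. -/
noncomputable def simpleRoot {S : Type*} [DecidableEq S] (s : S) : S → ℝ :=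
  Pi.single s 1

/-- The action of the generator `s` in the canonical representation:
`v ↦ v - ⟨v, α_s⟩ α_s`. -/
noncomputable def simpleReflection {S : Type*} [Fintype S] [DecidableEq S] (M : CoxeterMatrix S)
    (s : S) : Function.End (S → ℝ) :=
  fun v => v - canonicalForm M v (simpleRoot s) • simpleRoot s

section CanonicalRepresentation

variable {S : Type*} (M : CoxeterMatrix S)

theorem bilinCoeff_self (s : S) : bilinCoeff M s s = 2 := by
  simp [bilinCoeff]

theorem bilinCoeff_comm (s t : S) : bilinCoeff M s t = bilinCoeff M t s := by
  simp [bilinCoeff, M.symmetric s t]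

theorem pi_div_natCast_mem_Icc (m : ℕ) : Real.pi / m ∈ Set.Icc 0 Real.pi := by
  refine ⟨by positivity, ?_⟩
  rcases Nat.eq_zero_or_pos m with rfl | hm
  · simpa using Real.pi_pos.le
  · exact div_le_self Real.pi_pos.le (by exact_mod_cast hm)

/-- Since `Real.pi / 0 = 0`, the case distinction in `bilinCoeff` is redundant. -/
theorem bilinCoeff_eq (s t : S) : bilinCoeff M s t = -2 * Real.cos (Real.pi / M s t) := by
  unfold bilinCoeff
  split_ifs with h <;> simp [h]

theorem coxeterMatrix_eq_of_bilinCoeff_eq {s t s' t' : S}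
    (h : bilinCoeff M s t = bilinCoeff M s' t') : M s t = M s' t' := by
  rw [bilinCoeff_eq, bilinCoeff_eq] at h
  have h' := Real.injOn_cos (pi_div_natCast_mem_Icc _) (pi_div_natCast_mem_Icc _)
    (mul_left_cancel₀ (by norm_num) h)
  rw [div_eq_mul_inv, div_eq_mul_inv] at h'
  exact_mod_cast inv_injective (mul_left_cancel₀ Real.pi_ne_zero h')

/-- The coefficients of the roots of a rank two parabolic subgroup with `m_{s,t} = m`, where `m = 0`
encodes `∞`. -/
noncomputable def dihedralCoeff (m k : ℕ) : ℝ :=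
  if m = 0 then k else Real.sin (k * (Real.pi / m)) / Real.sin (Real.pi / m)

theorem dihedralCoeff_zero (m : ℕ) : dihedralCoeff m 0 = 0 := by
  simp [dihedralCoeff]

theorem sin_pi_div_pos {m : ℕ} (h₀ : m ≠ 0) (h₁ : m ≠ 1) : 0 < Real.sin (Real.pi / m) := by
  refine Real.sin_pos_of_pos_of_lt_pi (by positivity) (div_lt_self Real.pi_pos ?_)
  exact_mod_cast (by omega : 1 < m)

theorem dihedralCoeff_one {m : ℕ} (hm : m ≠ 1) : dihedralCoeff m 1 = 1 := by
  unfold dihedralCoeff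
  split_ifs with h
  · simp
  · rw [Nat.cast_one, one_mul, div_self (sin_pi_div_pos h hm).ne']

theorem dihedralCoeff_nonneg {m : ℕ} (hm : m ≠ 1) {k : ℕ} (hk : m ≠ 0 → k ≤ m) :
    0 ≤ dihedralCoeff m k := by
  unfold dihedralCoeff
  split_ifs with h
  · positivity
  · refine div_nonneg (Real.sin_nonneg_of_nonneg_of_le_pi (by positivity) ?_)
      (sin_pi_div_pos h hm).le
    have hkm : (k : ℝ) ≤ m := by exact_mod_cast hk h
    have hm0 : (0 : ℝ) < m := by positivity
    calc (k : ℝ) * (Real.pi / m) ≤ m * (Real.pi / m) := by gcongr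
      _ = Real.pi := by field_simp

theorem dihedralCoeff_add_two (s t : S) (k : ℕ) :
    dihedralCoeff (M s t) (k + 2) =
      -bilinCoeff M s t * dihedralCoeff (M s t) (k + 1) - dihedralCoeff (M s t) k := by
  unfold dihedralCoeff bilinCoeff
  split_ifs with h
  · push_cast; ring
  · set θ := Real.pi / (M s t : ℝ)
    have h₂ : ((k + 2 : ℕ) : ℝ) * θ = ((k + 1 : ℕ) : ℝ) * θ + θ := by push_cast; ring
    have h₀ : (k : ℝ) * θ = ((k + 1 : ℕ) : ℝ) * θ - θ := by push_cast; ring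
    rw [h₂, h₀, Real.sin_add, Real.sin_sub]
    ring

theorem canonicalRep_mul {M : CoxeterMatrix S} {ρ : M.Group →* Function.End (S → ℝ)}
    (w w' : M.Group) (v : S → ℝ) : ρ (w * w') v = ρ w (ρ w' v) := by
  rw [map_mul]; rfl

variable [Fintype S]

theorem canonicalForm_add_left (u v w : S → ℝ) :
    canonicalForm M (u + v) w = canonicalForm M u w + canonicalForm M v w := by
  simp [canonicalForm, add_mul, Finset.sum_add_distrib]

theorem canonicalForm_smul_left (c : ℝ) (v w : S → ℝ) :
    canonicalForm M (c • v) w = c * canonicalForm M v w := by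
  simp [canonicalForm, Finset.mul_sum, mul_assoc]

theorem canonicalForm_comm (v w : S → ℝ) : canonicalForm M v w = canonicalForm M w v := by
  unfold canonicalForm
  rw [Finset.sum_comm]
  exact Finset.sum_congr rfl fun s _ => Finset.sum_congr rfl fun t _ => by
    rw [bilinCoeff_comm M, mul_comm (v t)]

variable [DecidableEq S]

theorem canonicalForm_simpleRoot (s t : S) :
    canonicalForm M (simpleRoot s) (simpleRoot t) = bilinCoeff M s t := by
  simp [canonicalForm, simpleRoot, Pi.single_apply]

theorem eq_sum_smul_simpleRoot (v : S → ℝ) : v = ∑ s, v s • simpleRoot s := by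
  ext t
  simp [simpleRoot, Pi.single_apply]

theorem simpleReflection_add (s : S) (v w : S → ℝ) :
    simpleReflection M s (v + w) = simpleReflection M s v + simpleReflection M s w := by
  simp only [simpleReflection, canonicalForm_add_left, add_smul]
  abel

theorem simpleReflection_smul (s : S) (c : ℝ) (v : S → ℝ) :
    simpleReflection M s (c • v) = c • simpleReflection M s v := by
  simp only [simpleReflection, canonicalForm_smul_left, mul_smul, smul_sub]

theorem simpleReflection_simpleRoot (s t : S) :
    simpleReflection M s (simpleRoot t) = simpleRoot t - bilinCoeff M t s • simpleRoot s := by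
  simp only [simpleReflection, canonicalForm_simpleRoot]

theorem canonicalForm_simpleReflection (s : S) (v w : S → ℝ) :
    canonicalForm M (simpleReflection M s v) (simpleReflection M s w) = canonicalForm M v w := by
  have h (v : S → ℝ) : simpleReflection M s v =
      v + (-canonicalForm M v (simpleRoot s)) • simpleRoot s := by
    rw [neg_smul, ← sub_eq_add_neg]; rfl
  rw [h v, h w, canonicalForm_add_left, canonicalForm_smul_left, canonicalForm_comm M v,
    canonicalForm_comm M (simpleRoot s), canonicalForm_add_left, canonicalForm_add_left,
    canonicalForm_smul_left, canonicalForm_smul_left, canonicalForm_simpleRoot, bilinCoeff_self,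
    canonicalForm_comm M w v, canonicalForm_comm M (simpleRoot s) v]
  ring

variable {M} {ρ : M.Group →* Function.End (S → ℝ)}
  (hρ : ∀ s : S, ρ (M.simple s) = simpleReflection M s)

include hρ

theorem isLinearMap_canonicalRep (w : M.Group) : IsLinearMap ℝ (ρ w) := by
  induction w using M.toCoxeterSystem.simple_induction_left with
  | one => rw [map_one]; exact ⟨fun _ _ => rfl, fun _ _ => rfl⟩
  | mul_simple_left w s ih =>
    rw [map_mul, M.toCoxeterSystem_simple, hρ]
    constructor
    · intro u v
      change simpleReflection M s (ρ w (u + v)) = _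
      rw [ih.map_add, simpleReflection_add]; rfl
    · intro c v
      change simpleReflection M s (ρ w (c • v)) = _
      rw [ih.map_smul, simpleReflection_smul]; rfl

theorem canonicalForm_canonicalRep (w : M.Group) (u v : S → ℝ) :
    canonicalForm M (ρ w u) (ρ w v) = canonicalForm M u v := by
  induction w using M.toCoxeterSystem.simple_induction_left with
  | one => rw [map_one]; rfl
  | mul_simple_left w s ih =>
    rw [map_mul, M.toCoxeterSystem_simple, hρ, ← ih]
    exact canonicalForm_simpleReflection M s _ _

theorem bilinCoeff_eq_canonicalForm (w : M.Group) (s t : S) :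
    bilinCoeff M s t = canonicalForm M (ρ w (simpleRoot s)) (ρ w (simpleRoot t)) := by
  rw [canonicalForm_canonicalRep hρ, canonicalForm_simpleRoot]

theorem canonicalRep_eq_sum (w : M.Group) (v : S → ℝ) :
    ρ w v = ∑ s, v s • ρ w (simpleRoot s) := by
  have h := congrArg ((isLinearMap_canonicalRep hρ w).mk' _) (eq_sum_smul_simpleRoot v)
  rwa [map_sum, Finset.sum_congr rfl fun s _ => map_smul _ _ _] at h

theorem canonicalRep_mul_simple (w : M.Group) (s : S) :
    ρ (w * M.simple s) (simpleRoot s) = -ρ w (simpleRoot s) := by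
  rw [canonicalRep_mul, hρ, simpleReflection_simpleRoot, bilinCoeff_self,
    show simpleRoot s - (2 : ℝ) • simpleRoot s = -simpleRoot s by rw [two_smul]; abel,
    (isLinearMap_canonicalRep hρ w).map_neg]

theorem canonicalRep_alternatingWord {s t : S} (hst : s ≠ t) (k : ℕ) :
    ρ (M.toCoxeterSystem.wordProd (CoxeterSystem.alternatingWord s t k)) (simpleRoot s) =
      dihedralCoeff (M s t) (if Even k then k + 1 else k) • simpleRoot s +
        dihedralCoeff (M s t) (if Even k then k else k + 1) • simpleRoot t := by
  induction k with
  | zero =>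
    simp [CoxeterSystem.alternatingWord, dihedralCoeff_zero,
      dihedralCoeff_one (M.off_diagonal s t hst)]
    rfl
  | succ k ih =>
    rw [CoxeterSystem.alternatingWord_succ', CoxeterSystem.wordProd_cons, canonicalRep_mul, ih,
      M.toCoxeterSystem_simple, hρ, simpleReflection_add, simpleReflection_smul,
      simpleReflection_smul, simpleReflection_simpleRoot, simpleReflection_simpleRoot]
    by_cases hk : Even k
    · have hk' : ¬ Even (k + 1) := by simpa [Nat.even_add_one] using hk
      simp only [hk, hk', if_true, if_false, bilinCoeff_self, dihedralCoeff_add_two]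
      module
    · have hk' : Even (k + 1) := by simpa [Nat.even_add_one] using hk
      simp only [hk, hk', if_true, if_false, bilinCoeff_self, dihedralCoeff_add_two,
        bilinCoeff_comm M t s]
      module

/-- An element `w` that does not have `s` as a right descent sends `α_s` to a positive root. -/
theorem canonicalRep_simpleRoot_nonneg (w : M.Group) (s : S)
    (hs : ¬ M.toCoxeterSystem.IsRightDescent w s) : 0 ≤ ρ w (simpleRoot s) := by
  induction hn : M.toCoxeterSystem.length w using Nat.strong_induction_on generalizing w s with
  | _ n ih =>
  subst hn
  set cs := M.toCoxeterSystem
  rcases eq_or_ne w 1 with rfl | hw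
  · rw [map_one]
    exact Pi.single_nonneg.mpr zero_le_one
  obtain ⟨t, ht⟩ := cs.exists_rightDescent_of_ne_one hw
  have hst : s ≠ t := by rintro rfl; exact hs ht
  let P : ℕ → Prop := fun k => ∃ v, w = v * cs.wordProd (CoxeterSystem.alternatingWord s t k) ∧
    cs.length w = cs.length v + k
  have hP1 : P 1 := by
    refine ⟨w * cs.simple t, by simp [CoxeterSystem.alternatingWord], ?_⟩
    rw [cs.isRightDescent_iff] at ht
    exact ht.symm
  have hPle (k : ℕ) (hk : P k) : k ≤ cs.length w := by
    obtain ⟨v, -, h⟩ := hk; omega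
  classical
  obtain ⟨k, hk1, ⟨v, hwv, hlen⟩, hmax⟩ : ∃ k, 1 ≤ k ∧ P k ∧ ¬ P (k + 1) := by
    refine ⟨Nat.findGreatest P (cs.length w), Nat.le_findGreatest (hPle 1 hP1) hP1,
      Nat.findGreatest_spec (hPle 1 hP1) hP1, fun h => ?_⟩
    have := Nat.le_findGreatest (hPle _ h) h
    omega
  have hnext : ¬ cs.IsRightDescent v (if Even k then t else s) := by
    intro h
    rw [cs.isRightDescent_iff] at h
    refine hmax ⟨v * cs.simple (if Even k then t else s), ?_, by omega⟩
    rw [CoxeterSystem.alternatingWord_succ', cs.wordProd_cons, mul_assoc,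
      cs.simple_mul_simple_cancel_left, ← hwv]
  have hprev : ¬ cs.IsRightDescent v (if Even k then s else t) := by
    intro h
    rw [cs.isRightDescent_iff] at h
    obtain ⟨j, rfl⟩ : ∃ j, k = j + 1 := ⟨k - 1, by omega⟩
    have hpar : (if Even (j + 1) then s else t) = if Even j then t else s := by
      by_cases hj : Even j <;> simp [Nat.even_add_one, hj]
    rw [hpar] at h
    rw [CoxeterSystem.alternatingWord_succ', cs.wordProd_cons, ← mul_assoc] at hwv
    have h₁ := cs.length_mul_le (v * cs.simple (if Even j then t else s))
      (cs.wordProd (CoxeterSystem.alternatingWord s t j))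
    have h₂ := cs.length_wordProd_le (CoxeterSystem.alternatingWord s t j)
    rw [CoxeterSystem.length_alternatingWord] at h₂
    rw [← hwv] at h₁
    omega
  have hv : ¬ cs.IsRightDescent v s ∧ ¬ cs.IsRightDescent v t := by
    by_cases hk : Even k <;> simp only [hk, if_true, if_false] at hnext hprev <;> tauto
  have hkm : M s t ≠ 0 → k + 1 ≤ M s t := by
    intro hm
    by_contra! hlt
    refine cs.not_isReduced_alternatingWord t s (m := k + 1) (by rwa [M.symmetric t s])
      (by rwa [M.symmetric t s]) ?_
    rw [cs.not_isRightDescent_iff, hwv, mul_assoc, ← cs.wordProd_concat,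
      ← CoxeterSystem.alternatingWord_succ, ← hwv] at hs
    have h₁ := cs.length_mul_le v (cs.wordProd (CoxeterSystem.alternatingWord t s (k + 1)))
    have h₂ := cs.length_wordProd_le (CoxeterSystem.alternatingWord t s (k + 1))
    rw [CoxeterSystem.IsReduced]
    rw [CoxeterSystem.length_alternatingWord] at h₂ ⊢
    omega
  have hmst := M.off_diagonal s t hst
  rw [hwv, canonicalRep_mul, canonicalRep_alternatingWord hρ hst,
    (isLinearMap_canonicalRep hρ v).map_add, (isLinearMap_canonicalRep hρ v).map_smul,
    (isLinearMap_canonicalRep hρ v).map_smul]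
  refine add_nonneg (smul_nonneg (dihedralCoeff_nonneg hmst fun h => ?_)
    (ih _ (by omega) v s hv.1 rfl)) (smul_nonneg (dihedralCoeff_nonneg hmst fun h => ?_)
    (ih _ (by omega) v t hv.2 rfl))
  all_goals
    have := hkm h
    split_ifs <;> omega

theorem canonicalRep_simpleRoot_nonneg_or_nonpos (w : M.Group) (s : S) :
    0 ≤ ρ w (simpleRoot s) ∨ ρ w (simpleRoot s) ≤ 0 := by
  by_cases h : M.toCoxeterSystem.IsRightDescent w s
  · right
    rw [CoxeterSystem.isRightDescent_iff_not_isRightDescent_mul] at h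
    have := canonicalRep_simpleRoot_nonneg hρ _ s h
    rwa [M.toCoxeterSystem_simple, canonicalRep_mul_simple hρ, Left.nonneg_neg_iff] at this
  · exact .inl (canonicalRep_simpleRoot_nonneg hρ w s h)

theorem canonicalRep_apply_eq_zero_of_notMem {X : Set S} {u : M.Group}
    (hu : u ∈ Subgroup.closure (M.simple '' X)) {v : S → ℝ} (hv : ∀ s ∉ X, v s = 0) :
    ∀ s ∉ X, ρ u v s = 0 := by
  have step (x : S) (hx : x ∈ X) (v : S → ℝ) (hv : ∀ s ∉ X, v s = 0) :
      ∀ s ∉ X, ρ (M.simple x) v s = 0 := by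
    intro s hs
    have : s ≠ x := by rintro rfl; exact hs hx
    simp [hρ, simpleReflection, simpleRoot, hv s hs, this]
  induction hu using Subgroup.closure_induction_left with
  | one => rwa [map_one]
  | mul_left g hg u _ ih =>
    obtain ⟨x, hx, rfl⟩ := hg
    rw [canonicalRep_mul]
    exact step x hx _ ih
  | inv_mul_cancel g hg u _ ih =>
    obtain ⟨x, hx, rfl⟩ := hg
    rw [canonicalRep_mul, ← M.toCoxeterSystem_simple, CoxeterSystem.inv_simple,
      M.toCoxeterSystem_simple]
    exact step x hx _ ih

/-- If `w` sends a simple root to a root of `Γ_X` and no element of `X` is a left descent of `w`,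
then the image is itself a simple root. -/
theorem exists_canonicalRep_eq_simpleRoot {X : Set S} {w : M.Group}
    (hw : ∀ x ∈ X, ¬ M.toCoxeterSystem.IsLeftDescent w x) {s : S}
    (hs : ∀ t ∉ X, ρ w (simpleRoot s) t = 0) : ∃ x ∈ X, ρ w (simpleRoot s) = simpleRoot x := by
  set β := ρ w (simpleRoot s) with hβ
  have hpos (x : S) (hx : x ∈ X) : 0 ≤ ρ w⁻¹ (simpleRoot x) := by
    refine canonicalRep_simpleRoot_nonneg hρ _ _ ?_
    rw [CoxeterSystem.isRightDescent_inv_iff]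
    exact hw x hx
  have hinv : ρ w⁻¹ β = simpleRoot s := by
    rw [hβ, ← canonicalRep_mul, inv_mul_cancel, map_one]; rfl
  have hsum : simpleRoot s = ∑ t, β t • ρ w⁻¹ (simpleRoot t) := by
    rw [← hinv, canonicalRep_eq_sum hρ]
  have hβ_nonneg : 0 ≤ β := by
    refine (canonicalRep_simpleRoot_nonneg_or_nonpos hρ w s).resolve_right fun hneg => ?_
    have : simpleRoot s ≤ (0 : S → ℝ) := by
      rw [hsum]
      refine Finset.sum_nonpos fun t _ => ?_
      by_cases ht : t ∈ X
      · exact smul_nonpos_of_nonpos_of_nonneg (hneg t) (hpos t ht)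
      · rw [hs t ht, zero_smul]
    have h1 := this s
    norm_num [simpleRoot] at h1
  obtain ⟨x, hx⟩ : ∃ x, β x ≠ 0 := by
    by_contra! h
    have h1 := congrFun hsum s
    simp [h, simpleRoot] at h1
  have hxX : x ∈ X := by
    by_contra h
    exact hx (hs x h)
  refine ⟨x, hxX, ?_⟩
  have hterm (t : S) : 0 ≤ β t • ρ w⁻¹ (simpleRoot t) := by
    by_cases ht : t ∈ X
    · exact smul_nonneg (hβ_nonneg t) (hpos t ht)
    · rw [hs t ht, zero_smul]
  have hzero (t : S) (ht : t ≠ s) : ρ w⁻¹ (simpleRoot x) t = 0 := by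
    have h1 : ∑ y, (β y • ρ w⁻¹ (simpleRoot y)) t = 0 := by
      rw [← Finset.sum_apply, ← hsum]
      simp [simpleRoot, ht]
    have h2 := (Finset.sum_eq_zero_iff_of_nonneg fun y _ => hterm y t).mp h1 x (Finset.mem_univ x)
    exact (mul_eq_zero.mp h2).resolve_left hx
  have hmul : ρ w⁻¹ (simpleRoot x) = (ρ w⁻¹ (simpleRoot x) s) • simpleRoot s := by
    ext t
    by_cases ht : t = s
    · subst ht; simp [simpleRoot]
    · rw [hzero t ht]; simp [simpleRoot, ht]
  have hnorm := bilinCoeff_eq_canonicalForm hρ w⁻¹ x x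
  rw [hmul, canonicalForm_smul_left, canonicalForm_comm, canonicalForm_smul_left,
    canonicalForm_simpleRoot, bilinCoeff_self, bilinCoeff_self] at hnorm
  have hone : ρ w⁻¹ (simpleRoot x) s = 1 := by
    have := hpos x hxX s
    rw [Pi.zero_apply] at this
    nlinarith
  rw [hone, one_smul] at hmul
  rw [hβ, ← hmul, ← canonicalRep_mul, mul_inv_cancel, map_one]
  rfl

/-- A single element of `W_X` carries all the images of simple roots under `w` that lie in the root
system of `Γ_X` back to simple roots. -/
theorem exists_mem_closure_forall_simpleRoot (X : Set S) (w : M.Group) :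
    ∃ h ∈ Subgroup.closure (M.simple '' X), ∀ s : S,
      (∃ u ∈ Subgroup.closure (M.simple '' X), ∃ x ∈ X,
        ρ u (simpleRoot x) = ρ w (simpleRoot s)) →
      ∃ y ∈ X, ρ h (simpleRoot y) = ρ w (simpleRoot s) := by
  let H := Subgroup.closure (M.simple '' X)
  obtain ⟨h, hmin⟩ : ∃ h : H, ∀ g : H, M.toCoxeterSystem.length ((h : M.Group)⁻¹ * w) ≤
      M.toCoxeterSystem.length ((g : M.Group)⁻¹ * w) :=
    ⟨_, fun g => Function.argmin_le (fun g : H => M.toCoxeterSystem.length ((g : M.Group)⁻¹ * w)) g⟩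
  refine ⟨h, h.2, fun s ⟨u, hu, x, hx, hux⟩ => ?_⟩
  have hdesc (y : S) (hy : y ∈ X) :
      ¬ M.toCoxeterSystem.IsLeftDescent ((h : M.Group)⁻¹ * w) y := by
    have hyH : M.toCoxeterSystem.simple y ∈ H := Subgroup.subset_closure ⟨y, hy, rfl⟩
    have := hmin (h * ⟨M.toCoxeterSystem.simple y, hyH⟩)
    rw [CoxeterSystem.IsLeftDescent, not_lt]
    rwa [Subgroup.coe_mul, mul_inv_rev, mul_assoc, CoxeterSystem.inv_simple] at this
  have hfix : ρ ((h : M.Group)⁻¹ * w) (simpleRoot s) = ρ ((h : M.Group)⁻¹ * u) (simpleRoot x) := by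
    rw [canonicalRep_mul, canonicalRep_mul, hux]
  obtain ⟨y, hy, hyeq⟩ := exists_canonicalRep_eq_simpleRoot hρ hdesc (s := s) (by
    rw [hfix]
    refine canonicalRep_apply_eq_zero_of_notMem hρ (H.mul_mem (H.inv_mem h.2) hu) fun t ht => ?_
    have : t ≠ x := by rintro rfl; exact ht hx
    simp [simpleRoot, this])
  refine ⟨y, hy, ?_⟩
  rw [← hyeq, ← canonicalRep_mul, mul_inv_cancel_left]

end CanonicalRepresentation

/-- **Lemma 3.8.** For `β, γ ∈ Φ[Γ_X]`, the entry of the Coxeter matrix `\hat M^X` of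
`\widehat{Γ_X}` at `(β, γ)` equals the entry of the Coxeter matrix `\hat M` of `\hat Γ` at
`(β, γ)`: the two defining conditions are equivalent, and all defining values agree. Here `ρ` is
the canonical representation of `W[Γ]` (recall `M s t = 0` encodes `m_{s,t} = ∞`). -/
theorem coxeter_hat_matrix_restriction {S : Type*} [Fintype S] [DecidableEq S]
    (M : CoxeterMatrix S) (X : Set S)
    (ρ : M.Group →* Function.End (S → ℝ))
    (hρ : ∀ s : S, ρ (M.simple s) = simpleReflection M s)
    (β γ : S → ℝ)
    (hβ : ∃ u ∈ Subgroup.closure (M.simple '' X), ∃ x ∈ X, ρ u (simpleRoot x) = β)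
    (hγ : ∃ u ∈ Subgroup.closure (M.simple '' X), ∃ x ∈ X, ρ u (simpleRoot x) = γ)
    (hne : β ≠ γ) :
    ((∃ x ∈ X, ∃ y ∈ X, ∃ u ∈ Subgroup.closure (M.simple '' X),
        ρ u (simpleRoot x) = β ∧ ρ u (simpleRoot y) = γ ∧ M x y ≠ 0) ↔
      (∃ s t : S, ∃ w : M.Group,
        ρ w (simpleRoot s) = β ∧ ρ w (simpleRoot t) = γ ∧ M s t ≠ 0)) ∧
    (∀ x ∈ X, ∀ y ∈ X, ∀ u ∈ Subgroup.closure (M.simple '' X),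
      ρ u (simpleRoot x) = β → ρ u (simpleRoot y) = γ →
      ∀ s t : S, ∀ w : M.Group,
        ρ w (simpleRoot s) = β → ρ w (simpleRoot t) = γ → M x y = M s t) := by
  refine ⟨⟨?_, ?_⟩, ?_⟩
  · rintro ⟨x, -, y, -, u, -, h⟩
    exact ⟨x, y, u, h⟩
  · rintro ⟨s, t, w, rfl, rfl, hst⟩
    obtain ⟨h, hh, hX⟩ := exists_mem_closure_forall_simpleRoot hρ X w
    obtain ⟨x, hx, hxs⟩ := hX s hβ
    obtain ⟨y, hy, hyt⟩ := hX t hγ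
    refine ⟨x, hx, y, hy, h, hh, hxs, hyt, ?_⟩
    rwa [coxeterMatrix_eq_of_bilinCoeff_eq M (s' := s) (t' := t)]
    rw [bilinCoeff_eq_canonicalForm hρ h, hxs, hyt, ← bilinCoeff_eq_canonicalForm hρ w]
  · rintro x - y - u - hx hy s t w hs ht
    apply coxeterMatrix_eq_of_bilinCoeff_eq M
    rw [bilinCoeff_eq_canonicalForm hρ u, hx, hy, bilinCoeff_eq_canonicalForm hρ w, hs, ht]
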